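/- arXiv:0906.1560 — 2 statements merged into one kernel-verified Lean document; each statement's English description precedes it below -/
import Mathlib

section
/- Given a conformal structure on U ⊆ ℝ^V for a triangle collection 𝒯, let F : U → ℝ be a smooth function with ∂F/∂f_i = K_i for every vertex i, and let f : (−ε, ε) → U be a smooth curve. Then at t = 0, d²(F ∘ f)/dt² = (1/2) Σ_{(i,j) ordered edges} (ℓ*_ij/ℓ_ij)(f_j′ − f_i′)² + Σ_{i ∈ V} K_i f_i″. -/
open Finset

/-- The angle at the vertex of a Euclidean triangle whose two adjacent sides have
lengths `a`, `b` and whose opposite side has length `c` (law of cosines). -/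
noncomputable def triAngle (a b c : ℝ) : ℝ :=
  Real.arccos ((a ^ 2 + b ^ 2 - c ^ 2) / (2 * a * b))

/-- `{i, j}` is an edge of the triangle collection `𝒯`. -/
def IsEdge {V : Type*} [DecidableEq V] (𝒯 : Finset (Finset V)) (i j : V) : Prop :=
  i ≠ j ∧ ∃ T ∈ 𝒯, i ∈ T ∧ j ∈ T

instance {V : Type*} [DecidableEq V] (𝒯 : Finset (Finset V)) (i j : V) :
    Decidable (IsEdge 𝒯 i j) := by
  unfold IsEdge; infer_instance

/-- A (two-dimensional) conformal structure on an open set `U ⊆ ℝ^V` for a collection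
`𝒯` of triangles: a smooth assignment `f ↦ d f i j` of reals to ordered edges, where
`d f i j` depends only on the coordinates `f i` and `f j`, the induced lengths
`ℓ i j = d i j + d j i` are positive and satisfy the strict triangle inequality on each
triangle, the metric condition holds on each triangle, and `∂ℓ_ij/∂f_i = d_ij`. -/
structure Conformal2D (V : Type*) [Fintype V] [DecidableEq V]
    (𝒯 : Finset (Finset V)) (U : Set (V → ℝ)) where
  d : (V → ℝ) → V → V → ℝ
  openU : IsOpen U
  card3 : ∀ T ∈ 𝒯, T.card = 3
  smooth : ∀ i j, IsEdge 𝒯 i j → ContDiffOn ℝ (⊤ : ℕ∞) (fun f => d f i j) U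
  localDep : ∀ i j, IsEdge 𝒯 i j → ∀ f g : V → ℝ, f i = g i → f j = g j →
    d f i j = d g i j
  lenPos : ∀ f ∈ U, ∀ i j, IsEdge 𝒯 i j → 0 < d f i j + d f j i
  triIneq : ∀ f ∈ U, ∀ T ∈ 𝒯, ∀ i ∈ T, ∀ j ∈ T, ∀ k ∈ T, i ≠ j → i ≠ k → j ≠ k →
    d f i j + d f j i < (d f i k + d f k i) + (d f j k + d f k j)
  metricCond : ∀ f ∈ U, ∀ T ∈ 𝒯, ∀ i ∈ T, ∀ j ∈ T, ∀ k ∈ T, i ≠ j → i ≠ k → j ≠ k →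
    d f i j ^ 2 + d f j k ^ 2 + d f k i ^ 2 = d f j i ^ 2 + d f k j ^ 2 + d f i k ^ 2
  derivLen : ∀ i j, IsEdge 𝒯 i j → ∀ f ∈ U,
    HasDerivAt (fun s : ℝ =>
        d (Function.update f i s) i j + d (Function.update f i s) j i)
      (d f i j) (f i)

namespace Conformal2D

variable {V : Type*} [Fintype V] [DecidableEq V] {𝒯 : Finset (Finset V)}
  {U : Set (V → ℝ)}

/-- The length `ℓ_ij = d_ij + d_ji`. -/
noncomputable def len (C : Conformal2D V 𝒯 U) (f : V → ℝ) (i j : V) : ℝ :=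
  C.d f i j + C.d f j i

/-- The angle `γ_{i,jk}` at vertex `i` in the triangle `{i, j, k}`. -/
noncomputable def ang (C : Conformal2D V 𝒯 U) (f : V → ℝ) (i j k : V) : ℝ :=
  triAngle (C.len f i j) (C.len f i k) (C.len f j k)

/-- `h_{ij,k} = (d_ik − d_ij cos γ_{i,jk}) / sin γ_{i,jk}`. -/
noncomputable def hh (C : Conformal2D V 𝒯 U) (f : V → ℝ) (i j k : V) : ℝ :=
  (C.d f i k - C.d f i j * Real.cos (C.ang f i j k)) / Real.sin (C.ang f i j k)

/-- The curvature `K_i = 2π − Σ_{{i,j,k} ∈ 𝒯} γ_{i,jk}` (each unordered triangle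
containing `i` counted once; the ordered double sum counts it twice, whence `1/2`). -/
noncomputable def K (C : Conformal2D V 𝒯 U) (f : V → ℝ) (i : V) : ℝ :=
  2 * Real.pi - (1 / 2) * ∑ j : V, ∑ k : V,
    if ({i, j, k} : Finset V) ∈ 𝒯 ∧ i ≠ j ∧ i ≠ k ∧ j ≠ k then C.ang f i j k else 0

/-- The dual length `ℓ*_ij = Σ_{{i,j,k} ∈ 𝒯} h_{ij,k}`. -/
noncomputable def dualLen (C : Conformal2D V 𝒯 U) (f : V → ℝ) (i j : V) : ℝ :=
  ∑ k : V,
    if ({i, j, k} : Finset V) ∈ 𝒯 ∧ i ≠ j ∧ i ≠ k ∧ j ≠ k then C.hh f i j k else 0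

end Conformal2D

/-- Chain rule along a curve, expressed through the partial derivatives. -/
theorem hasDerivAt_comp_of_partials {V : Type*} [Fintype V] [DecidableEq V]
    {G : (V → ℝ) → ℝ} {g : ℝ → V → ℝ} {p v : V → ℝ} {t : ℝ}
    (hG : DifferentiableAt ℝ G (g t))
    (hp : ∀ i, HasDerivAt (fun s : ℝ => G (Function.update (g t) i s)) (p i) (g t i))
    (hg : HasDerivAt g v t) :
    HasDerivAt (fun s => G (g s)) (∑ i, p i * v i) t := by
  have hpart : ∀ i, fderiv ℝ G (g t) (Pi.single i 1) = p i := fun i => by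
    have hG' : HasFDerivAt G (fderiv ℝ G (g t)) (Function.update (g t) i (g t i)) := by
      rw [Function.update_eq_self]; exact hG.hasFDerivAt
    exact (hG'.comp_hasDerivAt (g t i) (hasDerivAt_update (g t) i (g t i))).unique (hp i)
  have h := hG.hasFDerivAt.comp_hasDerivAt t hg
  have hsum : fderiv ℝ G (g t) v = ∑ i, p i * v i := by
    conv_lhs => rw [pi_eq_sum_univ' v, map_sum]
    refine Finset.sum_congr rfl fun i _ => ?_
    rw [map_smul, smul_eq_mul, mul_comm, ← hpart i]
  rw [← hsum]
  exact h

/-- Four times the area of the Euclidean triangle with side lengths `a`, `b`, `c`. -/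
noncomputable def fourArea (a b c : ℝ) : ℝ :=
  √((2 * a * b) ^ 2 - (a ^ 2 + b ^ 2 - c ^ 2) ^ 2)

section Triangle

variable {a b c : ℝ}

theorem fourArea_swap_right (a b c : ℝ) : fourArea a c b = fourArea a b c := by
  unfold fourArea; congr 1; ring

theorem fourArea_swap_left (a b c : ℝ) : fourArea b a c = fourArea a b c := by
  unfold fourArea; congr 1; ring

theorem heron_pos (ha : 0 < a) (hb : 0 < b) (hc : 0 < c) (hab : c < a + b) (hac : b < a + c)
    (hbc : a < b + c) : 0 < (2 * a * b) ^ 2 - (a ^ 2 + b ^ 2 - c ^ 2) ^ 2 := by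
  have h : (2 * a * b) ^ 2 - (a ^ 2 + b ^ 2 - c ^ 2) ^ 2
      = (a + b + c) * (a + b - c) * ((a + c - b) * (b + c - a)) := by ring
  rw [h]
  have h1 := sub_pos.2 hab
  have h2 := sub_pos.2 hac
  have h3 := sub_pos.2 hbc
  positivity

theorem cos_arg_sq (ha : 0 < a) (hb : 0 < b) :
    1 - ((a ^ 2 + b ^ 2 - c ^ 2) / (2 * a * b)) ^ 2
      = ((2 * a * b) ^ 2 - (a ^ 2 + b ^ 2 - c ^ 2) ^ 2) / (2 * a * b) ^ 2 := by
  field_simp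

theorem sin_triAngle (ha : 0 < a) (hb : 0 < b) :
    Real.sin (triAngle a b c) = fourArea a b c / (2 * a * b) := by
  rw [triAngle, Real.sin_arccos, cos_arg_sq ha hb, Real.sqrt_div' _ (sq_nonneg _),
    Real.sqrt_sq (by positivity), fourArea]

theorem abs_cos_arg_lt_one (ha : 0 < a) (hb : 0 < b) (hc : 0 < c) (hab : c < a + b)
    (hac : b < a + c) (hbc : a < b + c) : |(a ^ 2 + b ^ 2 - c ^ 2) / (2 * a * b)| < 1 := by
  rw [← sq_lt_one_iff_abs_lt_one, ← sub_pos, cos_arg_sq ha hb]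
  exact div_pos (heron_pos ha hb hc hab hac hbc) (by positivity)

theorem cos_triAngle (ha : 0 < a) (hb : 0 < b) (hc : 0 < c) (hab : c < a + b)
    (hac : b < a + c) (hbc : a < b + c) :
    Real.cos (triAngle a b c) = (a ^ 2 + b ^ 2 - c ^ 2) / (2 * a * b) := by
  have h := abs_lt.1 (abs_cos_arg_lt_one ha hb hc hab hac hbc)
  exact Real.cos_arccos h.1.le h.2.le

theorem fourArea_pos (ha : 0 < a) (hb : 0 < b) (hc : 0 < c) (hab : c < a + b)
    (hac : b < a + c) (hbc : a < b + c) : 0 < fourArea a b c :=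
  Real.sqrt_pos.2 (heron_pos ha hb hc hab hac hbc)

/-- Derivative of the angle of a triangle with varying side lengths. -/
theorem HasDerivAt.triAngle {α β γ : ℝ → ℝ} {α' β' γ' t : ℝ} (hα : HasDerivAt α α' t)
    (hβ : HasDerivAt β β' t) (hγ : HasDerivAt γ γ' t) (ha : 0 < α t) (hb : 0 < β t)
    (hc : 0 < γ t) (hab : γ t < α t + β t) (hac : β t < α t + γ t) (hbc : α t < β t + γ t) :
    HasDerivAt (fun s => triAngle (α s) (β s) (γ s))
      ((2 * γ t * γ' - α' * (α t ^ 2 + γ t ^ 2 - β t ^ 2) / α t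
        - β' * (β t ^ 2 + γ t ^ 2 - α t ^ 2) / β t) / fourArea (α t) (β t) (γ t)) t := by
  have hlt := abs_lt.1 (abs_cos_arg_lt_one ha hb hc hab hac hbc)
  have hu := (((hα.pow 2).add (hβ.pow 2)).sub (hγ.pow 2)).div
    ((hα.const_mul 2).mul hβ) (by positivity : (2 * α t) * β t ≠ 0)
  have h := (Real.hasDerivAt_arccos hlt.1.ne' hlt.2.ne).comp t hu
  refine h.congr_deriv ?_
  have hD := fourArea_pos ha hb hc hab hac hbc
  have hs : √(1 - ((α t ^ 2 + β t ^ 2 - γ t ^ 2) / (2 * α t * β t)) ^ 2)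
      = fourArea (α t) (β t) (γ t) / (2 * α t * β t) := by
    rw [← Real.sin_arccos]; exact sin_triAngle ha hb
  rw [hs]
  simp only [Pi.add_apply, Pi.sub_apply, Pi.mul_apply, Pi.pow_apply]
  field_simp
  ring

end Triangle

/-- The Dirichlet energy of a symmetric weight as a sum over vertices. -/
theorem sum_mul_sum_sub_eq_energy {V : Type*} [Fintype V] (w : V → V → ℝ)
    (hw : ∀ i j, w i j = w j i) (v : V → ℝ) :
    ∑ i, -(∑ j, w i j * (v j - v i)) * v i
      = (1 / 2) * ∑ i, ∑ j, w i j * (v j - v i) ^ 2 := by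
  have h1 : ∑ i, -(∑ j, w i j * (v j - v i)) * v i
      = ∑ i, ∑ j, w i j * (v i - v j) * v i := by
    refine Finset.sum_congr rfl fun i _ => ?_
    rw [← Finset.sum_neg_distrib, Finset.sum_mul]
    exact Finset.sum_congr rfl fun j _ => by ring
  have h2 : ∑ i, ∑ j, w i j * (v i - v j) * v i
      = ∑ i, ∑ j, w i j * (v j - v i) * v j := by
    rw [Finset.sum_comm]
    exact Finset.sum_congr rfl fun i _ => Finset.sum_congr rfl fun j _ => by rw [hw]
  have h3 : ∑ i, ∑ j, w i j * (v j - v i) ^ 2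
      = ∑ i, ∑ j, w i j * (v i - v j) * v i + ∑ i, ∑ j, w i j * (v j - v i) * v j := by
    simp only [← Finset.sum_add_distrib]
    exact Finset.sum_congr rfl fun i _ => Finset.sum_congr rfl fun j _ => by ring
  rw [h3, ← h2, h1]
  ring

/-- `i`, `j`, `k` are the distinct vertices of a triangle of `𝒯`. -/
abbrev IsTriangle {V : Type*} [DecidableEq V] (𝒯 : Finset (Finset V)) (i j k : V) : Prop :=
  ({i, j, k} : Finset V) ∈ 𝒯 ∧ i ≠ j ∧ i ≠ k ∧ j ≠ k

section Combinatorics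

variable {V : Type*} [DecidableEq V] {𝒯 : Finset (Finset V)} {i j k : V}

theorem IsEdge.symm (h : IsEdge 𝒯 i j) : IsEdge 𝒯 j i := by
  obtain ⟨hne, T, hT, hi, hj⟩ := h
  exact ⟨hne.symm, T, hT, hj, hi⟩

theorem IsTriangle.swap_left (h : IsTriangle 𝒯 i j k) : IsTriangle 𝒯 j i k :=
  ⟨by rw [Finset.insert_comm]; exact h.1, h.2.1.symm, h.2.2.2, h.2.2.1⟩

theorem IsTriangle.swap_right (h : IsTriangle 𝒯 i j k) : IsTriangle 𝒯 i k j :=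
  ⟨by rw [Finset.pair_comm]; exact h.1, h.2.2.1, h.2.1, h.2.2.2.symm⟩

theorem IsTriangle.isEdge (h : IsTriangle 𝒯 i j k) : IsEdge 𝒯 i j :=
  ⟨h.2.1, _, h.1, by simp, by simp⟩

end Combinatorics

namespace Conformal2D

variable {V : Type*} [Fintype V] [DecidableEq V] {𝒯 : Finset (Finset V)}
  {U : Set (V → ℝ)} (C : Conformal2D V 𝒯 U) {f : V → ℝ} {i j k : V}

theorem len_comm (f : V → ℝ) (i j : V) : C.len f i j = C.len f j i := add_comm _ _

theorem len_lt_add (hf : f ∈ U) (h : IsTriangle 𝒯 i j k) :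
    C.len f i j < C.len f i k + C.len f j k :=
  C.triIneq f hf _ h.1 i (by simp) j (by simp) k (by simp) h.2.1 h.2.2.1 h.2.2.2

theorem hasDerivAt_len {g : ℝ → V → ℝ} {v : V → ℝ} {t : ℝ} (hg : HasDerivAt g v t)
    (hgt : g t ∈ U) (h : IsEdge 𝒯 i j) :
    HasDerivAt (fun s => C.len (g s) i j) (C.d (g t) i j * v i + C.d (g t) j i * v j) t := by
  have hdiff : ∀ i j, IsEdge 𝒯 i j → DifferentiableAt ℝ (fun f => C.d f i j) (g t) :=
    fun i j h => ((C.smooth i j h).contDiffAt (C.openU.mem_nhds hgt)).differentiableAt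
      (by simp)
  have key := hasDerivAt_comp_of_partials (G := fun f => C.len f i j)
    (p := fun l => if l = i then C.d (g t) i j else if l = j then C.d (g t) j i else 0)
    ((hdiff i j h).add (hdiff j i h.symm)) (fun l => ?_) hg
  · refine key.congr_deriv ?_
    rw [← Finset.sum_subset (Finset.subset_univ {i, j}), Finset.sum_pair h.1]
    · simp [h.1.symm]
    · intro l _ hl
      simp only [Finset.mem_insert, Finset.mem_singleton, not_or] at hl
      simp [hl.1, hl.2]
  · by_cases hli : l = i
    · subst hli
      simpa [len] using C.derivLen l j h _ hgt
    by_cases hlj : l = j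
    · subst hlj
      simpa [len, hli, add_comm] using C.derivLen l i h.symm _ hgt
    · have hconst : (fun s : ℝ => C.len (Function.update (g t) l s) i j)
          = fun _ => C.len (g t) i j := by
        ext s
        have hi : Function.update (g t) l s i = g t i := Function.update_of_ne (Ne.symm hli) _ _
        have hj : Function.update (g t) l s j = g t j := Function.update_of_ne (Ne.symm hlj) _ _
        simp only [len]
        rw [C.localDep i j h _ _ hi hj, C.localDep j i h.symm _ _ hj hi]
      simp only [hconst, hli, hlj, if_false]
      exact hasDerivAt_const _ _

theorem hh_eq (hf : f ∈ U) (h : IsTriangle 𝒯 i j k) :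
    C.hh f i j k = (2 * C.len f i j * C.len f i k * C.d f i k
      - C.d f i j * (C.len f i j ^ 2 + C.len f i k ^ 2 - C.len f j k ^ 2))
      / fourArea (C.len f i j) (C.len f i k) (C.len f j k) := by
  have ha : 0 < C.len f i j := C.lenPos f hf i j h.isEdge
  have hb : 0 < C.len f i k := C.lenPos f hf i k h.swap_right.isEdge
  have hc : 0 < C.len f j k := C.lenPos f hf j k h.swap_left.swap_right.isEdge
  have hab := C.len_lt_add hf h
  have hac := C.len_lt_add hf h.swap_right
  have hbc := C.len_lt_add hf h.swap_left.swap_right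
  rw [C.len_comm f k j] at hac
  rw [C.len_comm f j i, C.len_comm f k i] at hbc
  have hD := fourArea_pos ha hb hc (by linarith) (by linarith) (by linarith)
  rw [hh, ang, sin_triAngle ha hb,
    cos_triAngle ha hb hc (by linarith) (by linarith) (by linarith)]
  field_simp

theorem hh_comm (hf : f ∈ U) (h : IsTriangle 𝒯 i j k) : C.hh f i j k = C.hh f j i k := by
  rw [C.hh_eq hf h, C.hh_eq hf h.swap_left, C.len_comm f j i,
    fourArea_swap_right (C.len f i j) (C.len f i k)]
  congr 1
  have hm := C.metricCond f hf _ h.1 i (by simp) j (by simp) k (by simp) h.2.1 h.2.2.1 h.2.2.2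
  simp only [len]
  linear_combination -(C.d f i j + C.d f j i) * hm

theorem dualLen_comm (hf : f ∈ U) (i j : V) : C.dualLen f i j = C.dualLen f j i := by
  refine Finset.sum_congr rfl fun k _ => ?_
  by_cases h : IsTriangle 𝒯 i j k
  · rw [if_pos h, if_pos h.swap_left, C.hh_comm hf h]
  · rw [if_neg h, if_neg fun h' => h (IsTriangle.swap_left h')]

theorem dualLen_eq_zero (f : V → ℝ) (h : ¬ IsEdge 𝒯 i j) : C.dualLen f i j = 0 :=
  Finset.sum_eq_zero fun _ _ => if_neg fun h' => h (IsTriangle.isEdge h')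

theorem hasDerivAt_ang {g : ℝ → V → ℝ} {v : V → ℝ} {t : ℝ} (hg : HasDerivAt g v t)
    (hgt : g t ∈ U) (h : IsTriangle 𝒯 i j k) :
    HasDerivAt (fun s => C.ang (g s) i j k)
      (C.hh (g t) i j k / C.len (g t) i j * (v j - v i)
        + C.hh (g t) i k j / C.len (g t) i k * (v k - v i)) t := by
  have hij := h.isEdge
  have hik := h.swap_right.isEdge
  have hjk := h.swap_left.swap_right.isEdge
  have ha : 0 < C.len (g t) i j := C.lenPos _ hgt i j hij
  have hb : 0 < C.len (g t) i k := C.lenPos _ hgt i k hik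
  have hc : 0 < C.len (g t) j k := C.lenPos _ hgt j k hjk
  have hab := C.len_lt_add hgt h
  have hac := C.len_lt_add hgt h.swap_right
  have hbc := C.len_lt_add hgt h.swap_left.swap_right
  rw [C.len_comm _ k j] at hac
  rw [C.len_comm _ j i, C.len_comm _ k i] at hbc
  have hD := fourArea_pos ha hb hc (by linarith) (by linarith) (by linarith)
  refine ((C.hasDerivAt_len hg hgt hij).triAngle (C.hasDerivAt_len hg hgt hik)
    (C.hasDerivAt_len hg hgt hjk) ha hb hc (by linarith) (by linarith)
    (by linarith)).congr_deriv ?_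
  have e1 : C.hh (g t) i j k / C.len (g t) i j * (v j - v i)
      = C.hh (g t) j i k / C.len (g t) i j * v j
        - C.hh (g t) i j k / C.len (g t) i j * v i := by rw [C.hh_comm hgt h]; ring
  have e2 : C.hh (g t) i k j / C.len (g t) i k * (v k - v i)
      = C.hh (g t) k i j / C.len (g t) i k * v k
        - C.hh (g t) i k j / C.len (g t) i k * v i := by
    rw [C.hh_comm hgt h.swap_right]; ring
  rw [e1, e2, C.hh_eq hgt h, C.hh_eq hgt h.swap_left, C.hh_eq hgt h.swap_right,
    C.hh_eq hgt h.swap_right.swap_left, C.len_comm _ j i, C.len_comm _ k i, C.len_comm _ k j,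
    fourArea_swap_right (C.len (g t) i j) (C.len (g t) i k) (C.len (g t) j k),
    fourArea_swap_left (C.len (g t) i j) (C.len (g t) i k) (C.len (g t) j k),
    fourArea_swap_right (C.len (g t) i k) (C.len (g t) i j) (C.len (g t) j k),
    fourArea_swap_left (C.len (g t) i j) (C.len (g t) i k) (C.len (g t) j k)]
  field_simp
  ring

theorem hasDerivAt_K {g : ℝ → V → ℝ} {v : V → ℝ} {t : ℝ} (hg : HasDerivAt g v t)
    (hgt : g t ∈ U) (i : V) :
    HasDerivAt (fun s => C.K (g s) i)
      (-∑ j, C.dualLen (g t) i j / C.len (g t) i j * (v j - v i)) t := by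
  set A : V → V → ℝ := fun j k =>
    if IsTriangle 𝒯 i j k then C.hh (g t) i j k / C.len (g t) i j * (v j - v i) else 0
  have hterm : ∀ j k, HasDerivAt
      (fun s => if IsTriangle 𝒯 i j k then C.ang (g s) i j k else 0) (A j k + A k j) t := by
    intro j k
    by_cases h : IsTriangle 𝒯 i j k
    · simp only [A, if_pos h, if_pos h.swap_right]
      exact C.hasDerivAt_ang hg hgt h
    · have h' : ¬ IsTriangle 𝒯 i k j := fun h' => h h'.swap_right
      simp only [A, if_neg h, if_neg h', add_zero]
      exact hasDerivAt_const _ _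
  have hsum := ((HasDerivAt.fun_sum (u := univ) fun j _ =>
    HasDerivAt.fun_sum (u := univ) fun k _ => hterm j k).const_mul (1 / 2)).const_sub
      (2 * Real.pi)
  refine hsum.congr_deriv ?_
  have hA : ∑ j, C.dualLen (g t) i j / C.len (g t) i j * (v j - v i) = ∑ j, ∑ k, A j k := by
    refine Finset.sum_congr rfl fun j _ => ?_
    rw [dualLen, Finset.sum_div, Finset.sum_mul]
    refine Finset.sum_congr rfl fun k _ => ?_
    simp only [A]
    split_ifs <;> simp
  have hswap : ∑ j, ∑ k, A k j = ∑ j, ∑ k, A j k := Finset.sum_comm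
  rw [hA]
  simp only [Finset.sum_add_distrib]
  rw [hswap]
  ring

end Conformal2D

open Conformal2D in
/-- If `F` is a smooth function with `∂F/∂f_i = K_i` and `f(t)` is a
conformal variation, then at `t = 0`,
`d²(F∘f)/dt² = (1/2) Σ_{(i,j) ordered edges} (ℓ*_ij/ℓ_ij)(f_j′ − f_i′)² + Σ_i K_i f_i″`. -/
theorem second_variation_2d {V : Type*} [Fintype V] [DecidableEq V]
    {𝒯 : Finset (Finset V)} {U : Set (V → ℝ)} (C : Conformal2D V 𝒯 U)
    (F : (V → ℝ) → ℝ) (hF : ContDiffOn ℝ (⊤ : ℕ∞) F U)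
    (hgrad : ∀ f ∈ U, ∀ i : V,
      HasDerivAt (fun s : ℝ => F (Function.update f i s)) (C.K f i) (f i))
    (ε : ℝ) (hε : 0 < ε) (f : ℝ → (V → ℝ))
    (hmem : ∀ t ∈ Set.Ioo (-ε) ε, f t ∈ U)
    (hsmooth : ContDiffOn ℝ (⊤ : ℕ∞) f (Set.Ioo (-ε) ε)) :
    deriv (deriv (fun t => F (f t))) 0
      = (1 / 2) * (∑ i : V, ∑ j : V,
          if IsEdge 𝒯 i j then
            C.dualLen (f 0) i j / C.len (f 0) i j
              * (deriv (fun t => f t j) 0 - deriv (fun t => f t i) 0) ^ 2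
          else 0)
        + ∑ i : V, C.K (f 0) i * deriv (deriv (fun t => f t i)) 0 := by
  have hdf : ∀ t ∈ Set.Ioo (-ε) ε, HasDerivAt f (deriv f t) t := fun t ht =>
    ((hsmooth.contDiffAt (Ioo_mem_nhds ht.1 ht.2)).differentiableAt (by simp)).hasDerivAt
  have hcoord : ∀ t ∈ Set.Ioo (-ε) ε, ∀ i, deriv (fun s => f s i) t = deriv f t i :=
    fun t ht i => (hasDerivAt_pi.1 (hdf t ht) i).deriv
  have h0 : (0 : ℝ) ∈ Set.Ioo (-ε) ε := ⟨by linarith, hε⟩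
  have hnhds : Set.Ioo (-ε) ε ∈ nhds (0 : ℝ) := Ioo_mem_nhds h0.1 h0.2
  have hfirst : deriv (fun t => F (f t))
      =ᶠ[nhds 0] fun t => ∑ i, C.K (f t) i * deriv (fun s => f s i) t := by
    filter_upwards [hnhds] with t ht
    have hFd : DifferentiableAt ℝ F (f t) :=
      (hF.contDiffAt (C.openU.mem_nhds (hmem t ht))).differentiableAt (by simp)
    rw [(hasDerivAt_comp_of_partials hFd (hgrad _ (hmem t ht)) (hdf t ht)).deriv]
    exact Finset.sum_congr rfl fun i _ => by rw [hcoord t ht i]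
  have hsecond : ∀ i, HasDerivAt (deriv fun s => f s i)
      (deriv (deriv fun s => f s i) 0) 0 := fun i => by
    have hfi : ContDiffOn ℝ (⊤ : ℕ∞) (fun s => f s i) (Set.Ioo (-ε) ε) :=
      contDiffOn_pi.1 hsmooth i
    have := hfi.deriv_of_isOpen (m := 1) isOpen_Ioo (by norm_cast)
    exact ((this.contDiffAt hnhds).differentiableAt (by simp)).hasDerivAt
  have hsum := HasDerivAt.fun_sum (u := univ) fun i _ =>
    (C.hasDerivAt_K (hdf 0 h0) (hmem 0 h0) i).mul (hsecond i)
  rw [hfirst.deriv_eq]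
  refine hsum.deriv.trans ?_
  simp only [hcoord 0 h0, Finset.sum_add_distrib]
  congr 1
  rw [sum_mul_sum_sub_eq_energy (fun i j => C.dualLen (f 0) i j / C.len (f 0) i j)
    (fun i j => by rw [C.dualLen_comm (hmem 0 h0), C.len_comm])]
  congr 1
  refine Finset.sum_congr rfl fun i _ => Finset.sum_congr rfl fun j _ => ?_
  split_ifs with h
  · rfl
  · rw [C.dualLen_eq_zero _ h]; simp
end

section
/- Let ℓ_ij (1 ≤ i < j ≤ 4) be the edge lengths of a nondegenerate Euclidean tetrahedron and let d be a metric on it. Fix δ ∈ ℝ and consider the variation ℓ₁₂(t) = ℓ₁₂, ℓ₁₃(t) = ℓ₁₃, ℓ₂₃(t) = ℓ₂₃, ℓ₁₄(t) = ℓ₁₄ + t d₄₁ δ, ℓ₂₄(t) = ℓ₂₄ + t d₄₂ δ, ℓ₃₄(t) = ℓ₃₄ + t d₄₃ δ. Then at t = 0, d₁₄ (d/dt)β_{14,23} + d₁₂ (d/dt)β_{12,34} + d₁₃ (d/dt)β_{13,24} = 2 (A_{14,23}/ℓ₁₄) δ. -/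
/-- The dihedral angle `β_{ij,kl}` at the edge `{i,j}` of the tetrahedron `{i,j,k,l}`
with edge lengths `a = ℓ_ij`, `b = ℓ_ik`, `c = ℓ_il`, `p = ℓ_jk`, `q = ℓ_jl`,
`r = ℓ_kl`, via the spherical law of cosines:
`β_{ij,kl} = arccos((cos γ_{i,kl} − cos γ_{i,jk} cos γ_{i,jl})/(sin γ_{i,jk} sin γ_{i,jl}))`. -/
noncomputable def dihedralAngle (a b c p q r : ℝ) : ℝ :=
  Real.arccos ((Real.cos (triAngle b c r)
      - Real.cos (triAngle a b p) * Real.cos (triAngle a c q)) /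
    (Real.sin (triAngle a b p) * Real.sin (triAngle a c q)))

/-- `h_{ij,k} = (d_ik − d_ij cos γ_{i,jk})/sin γ_{i,jk}` as a function of `d_ik`,
`d_ij` and `γ = γ_{i,jk}`. -/
noncomputable def hFace (dik dij γ : ℝ) : ℝ := (dik - dij * Real.cos γ) / Real.sin γ

/-- `h_{ijk,l} = (h_{ij,l} − h_{ij,k} cos β_{ij,kl})/sin β_{ij,kl}` as a function of
`h_{ij,l}`, `h_{ij,k}` and `β = β_{ij,kl}`. -/
noncomputable def hTet (hijl hijk β : ℝ) : ℝ := (hijl - hijk * Real.cos β) / Real.sin β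

/-- The Cayley–Menger determinant of a tetrahedron with edge lengths
`a = ℓ₁₂`, `b = ℓ₁₃`, `c = ℓ₁₄`, `p = ℓ₂₃`, `q = ℓ₂₄`, `r = ℓ₃₄`. -/
noncomputable def cmDet (a b c p q r : ℝ) : ℝ :=
  Matrix.det !![(0 : ℝ), 1, 1, 1, 1;
    1, 0, a ^ 2, b ^ 2, c ^ 2;
    1, a ^ 2, 0, p ^ 2, q ^ 2;
    1, b ^ 2, p ^ 2, 0, r ^ 2;
    1, c ^ 2, q ^ 2, r ^ 2, 0]

/-- Heron's formula for the area of a triangle with side lengths `a`, `b`, `c`. -/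
noncomputable def heronArea (a b c : ℝ) : ℝ :=
  Real.sqrt ((a + b + c) * (-a + b + c) * (a - b + c) * (a + b - c)) / 4

open Real in
/-- The sine of the angle with cosine `(Z - X * Y) / (√(1 - X ^ 2) * √(1 - Y ^ 2))`. -/
lemma one_sub_sphericalCos_sq {X Y Z : ℝ} (hX : 0 < 1 - X ^ 2) (hY : 0 < 1 - Y ^ 2)
    (hW : 0 < 1 - X ^ 2 - Y ^ 2 - Z ^ 2 + 2 * X * Y * Z) :
    1 - ((Z - X * Y) / (√(1 - X ^ 2) * √(1 - Y ^ 2))) ^ 2 =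
      (√(1 - X ^ 2 - Y ^ 2 - Z ^ 2 + 2 * X * Y * Z) / (√(1 - X ^ 2) * √(1 - Y ^ 2))) ^ 2 := by
  rw [div_pow, div_pow, mul_pow, sq_sqrt hX.le, sq_sqrt hY.le, sq_sqrt hW.le]
  field_simp
  ring

lemma sphericalAngle_deriv_eq {X Y Z x' y' z' u v w : ℝ} (hu0 : 0 < u) (hv0 : 0 < v)
    (hw0 : 0 < w) (hu : u ^ 2 = 1 - X ^ 2) (hv : v ^ 2 = 1 - Y ^ 2) :
    -(1 / (w / (u * v))) * (((z' - (x' * Y + X * y')) * (u * v) -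
        (Z - X * Y) * (-(X * x') / u * v + u * (-(Y * y') / v))) / (u * v) ^ 2) =
      -(z' + x' * (X * Z - Y) / (1 - X ^ 2) + y' * (Y * Z - X) / (1 - Y ^ 2)) / w := by
  rw [← hu, ← hv]
  field_simp
  have e1 : X ^ 2 = 1 - u ^ 2 := by linarith
  have e2 : Y ^ 2 = 1 - v ^ 2 := by linarith
  grind

open Real in
lemma HasDerivAt.sqrt_one_sub_sq {x : ℝ → ℝ} {x' t : ℝ} (hx : HasDerivAt x x' t)
    (hx1 : 0 < 1 - x t ^ 2) :
    HasDerivAt (fun s => √(1 - x s ^ 2)) (-(x t * x') / √(1 - x t ^ 2)) t := by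
  refine (((hx.pow 2).const_sub 1).sqrt hx1.ne').congr_deriv ?_
  simp
  field_simp

open Real in
lemma cos_arccos_of_one_sub_sq_pos {x : ℝ} (h : 0 < 1 - x ^ 2) : cos (arccos x) = x :=
  cos_arccos (by nlinarith) (by nlinarith)

open Real in
lemma eventually_cos_arccos {f : ℝ → ℝ} {f' t : ℝ} (hf : HasDerivAt f f' t)
    (h : 0 < 1 - f t ^ 2) : ∀ᶠ s in nhds t, cos (arccos (f s)) = f s := by
  have hc : ContinuousAt (fun s => 1 - f s ^ 2) t :=
    continuousAt_const.sub (hf.continuousAt.pow 2)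
  filter_upwards [hc.eventually (lt_mem_nhds h)] with s hs
  exact cos_arccos_of_one_sub_sq_pos hs

open Real in
/-- Derivative of the angle given by the spherical law of cosines, in terms of the cosines
`x`, `y` of the adjacent sides and `z` of the opposite side. -/
lemma hasDerivAt_sphericalAngle {x y z : ℝ → ℝ} {x' y' z' t : ℝ}
    (hx : HasDerivAt x x' t) (hy : HasDerivAt y y' t) (hz : HasDerivAt z z' t)
    (hx1 : 0 < 1 - x t ^ 2) (hy1 : 0 < 1 - y t ^ 2) (hz1 : 0 < 1 - z t ^ 2)
    (hW : 0 < 1 - x t ^ 2 - y t ^ 2 - z t ^ 2 + 2 * x t * y t * z t) :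
    HasDerivAt (fun s => arccos ((cos (arccos (z s)) - cos (arccos (x s)) * cos (arccos (y s))) /
        (sin (arccos (x s)) * sin (arccos (y s)))))
      (-(z' + x' * (x t * z t - y t) / (1 - x t ^ 2) + y' * (y t * z t - x t) / (1 - y t ^ 2)) /
        √(1 - x t ^ 2 - y t ^ 2 - z t ^ 2 + 2 * x t * y t * z t)) t := by
  have px := sqrt_pos.2 hx1
  have py := sqrt_pos.2 hy1
  have pW := sqrt_pos.2 hW
  have hu := (hz.sub (hx.mul hy)).div ((hx.sqrt_one_sub_sq hx1).mul (hy.sqrt_one_sub_sq hy1))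
    (mul_pos px py).ne'
  have key := one_sub_sphericalCos_sq hx1 hy1 hW
  have key0 : 0 < 1 - ((z t - x t * y t) / (√(1 - x t ^ 2) * √(1 - y t ^ 2))) ^ 2 := by
    rw [key]; positivity
  have main := (hasDerivAt_arccos (x := (z t - x t * y t) / (√(1 - x t ^ 2) * √(1 - y t ^ 2)))
    (by intro h; rw [h] at key0; norm_num at key0)
    (by intro h; rw [h] at key0; norm_num at key0)).comp t hu
  refine HasDerivAt.congr_of_eventuallyEq (main.congr_deriv ?_) ?_
  · rw [key, sqrt_sq (by positivity)]
    exact sphericalAngle_deriv_eq px py pW (sq_sqrt hx1.le) (sq_sqrt hy1.le)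
  · filter_upwards [eventually_cos_arccos hx hx1, eventually_cos_arccos hy hy1,
      eventually_cos_arccos hz hz1] with s h1 h2 h3
    simp [h1, h2, h3, sin_arccos]

open Real in
/-- The formula for a dihedral angle degenerates to a constant as soon as one of the adjacent
faces violates the triangle inequality. -/
lemma deriv_sphericalAngle_of_degenerate {x : ℝ → ℝ} (y z : ℝ → ℝ) {t : ℝ}
    (hx : ContinuousAt x t) (hx1 : 1 - x t ^ 2 < 0) :
    deriv (fun s => arccos ((cos (arccos (z s)) - cos (arccos (x s)) * cos (arccos (y s))) /
        (sin (arccos (x s)) * sin (arccos (y s))))) t = 0 := by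
  have hc : ContinuousAt (fun s => 1 - x s ^ 2) t := continuousAt_const.sub (hx.pow 2)
  have h : (fun s => arccos ((cos (arccos (z s)) - cos (arccos (x s)) * cos (arccos (y s))) /
        (sin (arccos (x s)) * sin (arccos (y s))))) =ᶠ[nhds t] fun _ => arccos 0 := by
    filter_upwards [hc.eventually (gt_mem_nhds hx1)] with s hs
    simp [sin_arccos, sqrt_eq_zero_of_nonpos hs.le]
  rw [h.deriv_eq, deriv_const]

/-- First variation of the cosine of a face angle under a conformal variation of the metric at
the endpoint of an edge. -/
lemma hasDerivAt_cosFaceAngle {a b c dab dba dac dca dbc dcb : ℝ} (δ : ℝ)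
    (ha : 0 < a) (hb : 0 < b)
    (h1 : dab + dba = b) (h2 : dac + dca = a) (h3 : dbc + dcb = c)
    (hm : dab ^ 2 + dbc ^ 2 + dca ^ 2 = dba ^ 2 + dcb ^ 2 + dac ^ 2) :
    HasDerivAt (fun t : ℝ => ((a + t * (dca * δ)) ^ 2 + b ^ 2 - (c + t * (dcb * δ)) ^ 2) /
        (2 * (a + t * (dca * δ)) * b))
      (((a ^ 2 + b ^ 2 - c ^ 2) / (2 * a * b) * dac - dab) * (δ / a)) 0 := by
  have hA : HasDerivAt (fun t : ℝ => a + t * (dca * δ)) (dca * δ) 0 := by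
    simpa using ((hasDerivAt_id (0 : ℝ)).mul_const (dca * δ)).const_add a
  have hC : HasDerivAt (fun t : ℝ => c + t * (dcb * δ)) (dcb * δ) 0 := by
    simpa using ((hasDerivAt_id (0 : ℝ)).mul_const (dcb * δ)).const_add c
  have := (((hA.pow 2).add_const (b ^ 2)).sub (hC.pow 2)).div ((hA.const_mul 2).mul_const b)
    (by simp; exact ⟨ha.ne', hb.ne'⟩)
  refine this.congr_deriv ?_
  simp
  field_simp
  subst h1 h2 h3
  grind

lemma cmDet_eq (a b c p q r : ℝ) (ha : 0 < a) (hb : 0 < b) (hc : 0 < c) :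
    cmDet a b c p q r = 8 * a ^ 2 * b ^ 2 * c ^ 2 *
      (1 - ((a ^ 2 + b ^ 2 - p ^ 2) / (2 * a * b)) ^ 2
        - ((c ^ 2 + a ^ 2 - q ^ 2) / (2 * c * a)) ^ 2
        - ((c ^ 2 + b ^ 2 - r ^ 2) / (2 * c * b)) ^ 2
        + 2 * ((a ^ 2 + b ^ 2 - p ^ 2) / (2 * a * b)) * ((c ^ 2 + a ^ 2 - q ^ 2) / (2 * c * a))
          * ((c ^ 2 + b ^ 2 - r ^ 2) / (2 * c * b))) := by
  simp [cmDet, Matrix.det_succ_row_zero, Fin.sum_univ_succ, Fin.succAbove]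
  field_simp
  ring

/-- The identity of spherical trigonometry behind the variation formula: `X`, `Y`, `Z` are the
cosines of the face angles at a vertex, and `p`, `q`, `r` the weights of its edges. -/
lemma weighted_sphericalAngle_identity {X Y Z u v w p q r k : ℝ} (hu0 : 0 < u) (hv0 : 0 < v)
    (hw0 : 0 < w) (hZ : 0 < 1 - Z ^ 2) (hu : u ^ 2 = 1 - X ^ 2) (hv : v ^ 2 = 1 - Y ^ 2) :
    p * (-(0 + (X * p - q) * k * (X * Z - Y) / (1 - X ^ 2)
          + (Y * p - r) * k * (Y * Z - X) / (1 - Y ^ 2)) / w)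
      + q * (-((Y * p - r) * k + 0 * (Z * Y - X) / (1 - Z ^ 2)
          + (X * p - q) * k * (X * Y - Z) / (1 - X ^ 2)) / w)
      + r * (-((X * p - q) * k + 0 * (Z * X - Y) / (1 - Z ^ 2)
          + (Y * p - r) * k * (Y * X - Z) / (1 - Y ^ 2)) / w) =
    2 * (1 / 2 * ((q - p * X) / u *
          (((r - p * Y) / v - (q - p * X) / u * ((Z - X * Y) / (u * v))) / (w / (u * v)))
        + (r - p * Y) / v *
          (((q - p * X) / u - (r - p * Y) / v * ((Z - X * Y) / (u * v))) / (w / (u * v))))) * k := by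
  rw [← hu, ← hv]
  field_simp
  have e1 : X ^ 2 = 1 - u ^ 2 := by linarith
  have e2 : Y ^ 2 = 1 - v ^ 2 := by linarith
  grind

lemma triAngle_comm (a b c : ℝ) : triAngle a b c = triAngle b a c := by
  unfold triAngle
  congr 1
  ring

lemma dihedralAngle_eq_comm (a b c p q r : ℝ) : dihedralAngle a b c p q r =
    Real.arccos ((Real.cos (triAngle c b r)
      - Real.cos (triAngle a b p) * Real.cos (triAngle c a q)) /
    (Real.sin (triAngle a b p) * Real.sin (triAngle c a q))) := by
  rw [dihedralAngle, triAngle_comm c b, triAngle_comm c a]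

/-- For a nondegenerate tetrahedron with a metric `d`, under the variation
`ℓ₁₄(t) = ℓ₁₄ + t d₄₁ δ`, `ℓ₂₄(t) = ℓ₂₄ + t d₄₂ δ`, `ℓ₃₄(t) = ℓ₃₄ + t d₄₃ δ`,
at `t = 0`:
`d₁₄ β₁₄′ + d₁₂ β₁₂′ + d₁₃ β₁₃′ = 2 (A_{14,23}/ℓ₁₄) δ`. -/
theorem weighted_dihedral_variation_vertex1
    (l12 l13 l14 l23 l24 l34 : ℝ)
    (hp12 : 0 < l12) (hp13 : 0 < l13) (hp14 : 0 < l14)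
    (hp23 : 0 < l23) (hp24 : 0 < l24) (hp34 : 0 < l34)
    (hnd : 0 < cmDet l12 l13 l14 l23 l24 l34)
    (d12 d21 d13 d31 d14 d41 d23 d32 d24 d42 d34 d43 : ℝ)
    (hs12 : d12 + d21 = l12) (hs13 : d13 + d31 = l13) (hs14 : d14 + d41 = l14)
    (hs23 : d23 + d32 = l23) (hs24 : d24 + d42 = l24) (hs34 : d34 + d43 = l34)
    (hm123 : d12 ^ 2 + d23 ^ 2 + d31 ^ 2 = d21 ^ 2 + d32 ^ 2 + d13 ^ 2)
    (hm124 : d12 ^ 2 + d24 ^ 2 + d41 ^ 2 = d21 ^ 2 + d42 ^ 2 + d14 ^ 2)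
    (hm134 : d13 ^ 2 + d34 ^ 2 + d41 ^ 2 = d31 ^ 2 + d43 ^ 2 + d14 ^ 2)
    (hm234 : d23 ^ 2 + d34 ^ 2 + d42 ^ 2 = d32 ^ 2 + d43 ^ 2 + d24 ^ 2)
    (δ : ℝ) :
    let h142 := hFace d12 d14 (triAngle l14 l12 l24)      -- h_{14,2}
    let h143 := hFace d13 d14 (triAngle l14 l13 l34)      -- h_{14,3}
    let β1423 := dihedralAngle l14 l12 l13 l24 l34 l23    -- β_{14,23}
    let h1423 := hTet h143 h142 β1423                     -- h_{142,3}
    let h1432 := hTet h142 h143 β1423                     -- h_{143,2}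
    let A1423 := (1 / 2) * (h142 * h1423 + h143 * h1432)  -- A_{14,23}
    d14 * deriv (fun t : ℝ => dihedralAngle (l14 + t * (d41 * δ)) l12 l13
        (l24 + t * (d42 * δ)) (l34 + t * (d43 * δ)) l23) 0
      + d12 * deriv (fun t : ℝ => dihedralAngle l12 l13 (l14 + t * (d41 * δ)) l23
        (l24 + t * (d42 * δ)) (l34 + t * (d43 * δ))) 0
      + d13 * deriv (fun t : ℝ => dihedralAngle l13 l12 (l14 + t * (d41 * δ)) l23
        (l34 + t * (d43 * δ)) (l24 + t * (d42 * δ))) 0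
      = 2 * (A1423 / l14) * δ := by
  intro h142 h143 β1423 h1423 h1432 A1423
  have hx := hasDerivAt_cosFaceAngle δ hp14 hp12 hs12 hs14 hs24 hm124
  have hy := hasDerivAt_cosFaceAngle δ hp14 hp13 hs13 hs14 hs34 hm134
  rw [cmDet_eq _ _ _ _ _ _ hp12 hp13 hp14] at hnd
  have hW := pos_of_mul_pos_right hnd (by positivity)
  clear hnd
  have hTri : triAngle l13 l12 l23 = triAngle l12 l13 l23 := triAngle_comm _ _ _
  simp only [dihedralAngle_eq_comm l12 l13, dihedralAngle_eq_comm l13 l12, hTri]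
  simp only [A1423, h1423, h1432, β1423, h142, h143, hTet, hFace]
  clear A1423 h1423 h1432 β1423 h142 h143
  unfold dihedralAngle triAngle
  set x : ℝ → ℝ := fun t => ((l14 + t * (d41 * δ)) ^ 2 + l12 ^ 2 - (l24 + t * (d42 * δ)) ^ 2) /
        (2 * (l14 + t * (d41 * δ)) * l12)
  set y : ℝ → ℝ := fun t => ((l14 + t * (d41 * δ)) ^ 2 + l13 ^ 2 - (l34 + t * (d43 * δ)) ^ 2) /
        (2 * (l14 + t * (d41 * δ)) * l13)
  have hx0 : (l14 ^ 2 + l12 ^ 2 - l24 ^ 2) / (2 * l14 * l12) = x 0 := by simp [x]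
  have hy0 : (l14 ^ 2 + l13 ^ 2 - l34 ^ 2) / (2 * l14 * l13) = y 0 := by simp [y]
  rw [hx0] at hx hW ⊢
  rw [hy0] at hy hW ⊢
  generalize (l12 ^ 2 + l13 ^ 2 - l23 ^ 2) / (2 * l12 * l13) = z at *
  have hxy : 0 < (1 - x 0 ^ 2) * (1 - y 0 ^ 2) := by nlinarith [sq_nonneg (z - x 0 * y 0)]
  have hxz : 0 < (1 - x 0 ^ 2) * (1 - z ^ 2) := by nlinarith [sq_nonneg (y 0 - x 0 * z)]
  rcases lt_or_ge (1 - x 0 ^ 2) 0 with hneg | hpos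
  · have hyneg : 1 - y 0 ^ 2 < 0 := (neg_iff_neg_of_mul_pos hxy).1 hneg
    have hzneg : 1 - z ^ 2 < 0 := (neg_iff_neg_of_mul_pos hxz).1 hneg
    have E1 := deriv_sphericalAngle_of_degenerate y (fun _ => z) hx.continuousAt hneg
    have E2 := deriv_sphericalAngle_of_degenerate (x := fun _ => z) x y
      (t := 0) continuousAt_const hzneg
    have E3 := deriv_sphericalAngle_of_degenerate (x := fun _ => z) y x
      (t := 0) continuousAt_const hzneg
    simp only [x, y] at E1 E2 E3
    rw [E1, E2, E3]
    simp [Real.sin_arccos, Real.sqrt_eq_zero_of_nonpos hneg.le,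
      Real.sqrt_eq_zero_of_nonpos hyneg.le]
  · have hx1 : 0 < 1 - x 0 ^ 2 := lt_of_le_of_ne hpos (by rintro h; simp [← h] at hxy)
    have hy1 : 0 < 1 - y 0 ^ 2 := pos_of_mul_pos_right hxy hpos
    have hz1 : 0 < 1 - z ^ 2 := pos_of_mul_pos_right hxz hpos
    have hz := hasDerivAt_const (0 : ℝ) z
    have E1 := (hasDerivAt_sphericalAngle hx hy hz hx1 hy1 hz1 (by linarith)).deriv
    have E2 := (hasDerivAt_sphericalAngle hz hx hy hz1 hx1 hy1 (by linarith)).deriv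
    have E3 := (hasDerivAt_sphericalAngle hz hy hx hz1 hy1 hx1 (by linarith)).deriv
    have hW2 : 1 - z ^ 2 - x 0 ^ 2 - y 0 ^ 2 + 2 * z * x 0 * y 0 =
        1 - x 0 ^ 2 - y 0 ^ 2 - z ^ 2 + 2 * x 0 * y 0 * z := by ring
    have hW3 : 1 - z ^ 2 - y 0 ^ 2 - x 0 ^ 2 + 2 * z * y 0 * x 0 =
        1 - x 0 ^ 2 - y 0 ^ 2 - z ^ 2 + 2 * x 0 * y 0 * z := by ring
    have hW1 : 0 < 1 - x 0 ^ 2 - y 0 ^ 2 - z ^ 2 + 2 * x 0 * y 0 * z := by linarith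
    rw [hW2] at E2
    rw [hW3] at E3
    have key := one_sub_sphericalCos_sq hx1 hy1 hW1
    have px := Real.sqrt_pos.2 hx1
    have py := Real.sqrt_pos.2 hy1
    have pW := Real.sqrt_pos.2 hW1
    have hu := Real.sq_sqrt hx1.le
    have hv := Real.sq_sqrt hy1.le
    have key0 : 0 < 1 - ((z - x 0 * y 0) / (√(1 - x 0 ^ 2) * √(1 - y 0 ^ 2))) ^ 2 := by
      rw [key]; positivity
    refine (congrArg₂ (· + ·) (congrArg₂ (· + ·) (congrArg (d14 * ·) E1)
      (congrArg (d12 * ·) E2)) (congrArg (d13 * ·) E3)).trans ?_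
    rw [cos_arccos_of_one_sub_sq_pos hx1, cos_arccos_of_one_sub_sq_pos hy1,
      cos_arccos_of_one_sub_sq_pos hz1, Real.sin_arccos (x 0), Real.sin_arccos (y 0), Real.sin_arccos (_ / _),
      cos_arccos_of_one_sub_sq_pos key0, key,
      Real.sqrt_sq (by positivity)]
    refine (weighted_sphericalAngle_identity (p := d14) (q := d12) (r := d13) (k := δ / l14)
      px py pW hz1 hu hv).trans ?_
    ring
end
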